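/- Let a ≥ 1 be an integer and let G(a) be the subgroup of SL(2,ℤ) generated by A(a) = [[1,a],[0,1]] and B(a) = [[1,0],[a,1]]. For each positive integer n, let Γ(n) denote the principal congruence subgroup of SL(2,ℤ) of level n, i.e., the kernel of the reduction homomorphism SL(2,ℤ) → SL(2, ℤ/nℤ). Then the intersection over all positive integers n of the subgroups G(a)·Γ(n) equals G(a)·Γ(a²). -/

import Mathlib

open Matrix Pointwise

abbrev SL2 (R : Type*) [CommRing R] := Matrix.SpecialLinearGroup (Fin 2) R

/-- `A(x) = [[1,x],[0,1]]` as an element of `SL(2,R)`. -/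
def Amat {R : Type*} [CommRing R] (x : R) : SL2 R :=
  ⟨!![1, x; 0, 1], by simp [Matrix.det_fin_two_of]⟩

/-- `B(x) = [[1,0],[x,1]]` as an element of `SL(2,R)`. -/
def Bmat {R : Type*} [CommRing R] (x : R) : SL2 R :=
  ⟨!![1, 0; x, 1], by simp [Matrix.det_fin_two_of]⟩

/-- `G(x)`, the subgroup of `SL(2,R)` generated by `A(x)` and `B(x)`. -/
def Gx {R : Type*} [CommRing R] (x : R) : Subgroup (SL2 R) :=
  Subgroup.closure {Amat x, Bmat x}

/-- The product `H·N` of a subgroup with a normal subgroup, as a subgroup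
whose carrier is the set product. -/
def mulSubgroup {G : Type*} [Group G] (H N : Subgroup G) [N.Normal] : Subgroup G :=
  (H ⊔ N).copy ((H : Set G) * (N : Set G)) (Subgroup.mul_normal H N).symm

/-- The principal congruence subgroup `Γ(n)` of `SL(2,ℤ)` of level `n`. -/
abbrev PCSZ (n : ℕ) : Subgroup (SL2 ℤ) :=
  (Matrix.SpecialLinearGroup.map (Int.castRingHom (ZMod n))).ker

theorem coe_Amat {R : Type*} [CommRing R] (x : R) :
    (Amat x : Matrix (Fin 2) (Fin 2) R) = !![1, x; 0, 1] :=
  rfl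

theorem coe_Bmat {R : Type*} [CommRing R] (x : R) :
    (Bmat x : Matrix (Fin 2) (Fin 2) R) = !![1, 0; x, 1] :=
  rfl

/-- `A(x)` is additive in `x`. -/
theorem Amat_add {R : Type*} [CommRing R] (x y : R) : Amat (x + y) = Amat x * Amat y := by
  ext i j
  fin_cases i <;> fin_cases j <;> simp [coe_Amat, Matrix.mul_apply, Fin.sum_univ_two, add_comm]

/-- `B(x)` is additive in `x`. -/
theorem Bmat_add {R : Type*} [CommRing R] (x y : R) : Bmat (x + y) = Bmat x * Bmat y := by
  ext i j
  fin_cases i <;> fin_cases j <;> simp [coe_Bmat, Matrix.mul_apply, Fin.sum_univ_two]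

/-- `A` as a homomorphism from the additive group of the ring. -/
def AmatHom (R : Type*) [CommRing R] : Multiplicative R →* SL2 R :=
  MonoidHom.mk' (fun x => Amat x.toAdd) fun x y => Amat_add x.toAdd y.toAdd

/-- `B` as a homomorphism from the additive group of the ring. -/
def BmatHom (R : Type*) [CommRing R] : Multiplicative R →* SL2 R :=
  MonoidHom.mk' (fun x => Bmat x.toAdd) fun x y => Bmat_add x.toAdd y.toAdd

theorem Amat_mul_intCast_mem_Gx {R : Type*} [CommRing R] (x : R) (k : ℤ) :
    Amat (x * k) ∈ Gx x := by
  have h : Amat (x * k) = Amat x ^ k := by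
    have := map_zpow (AmatHom R) (Multiplicative.ofAdd x) k
    rw [← ofAdd_zsmul, zsmul_eq_mul, mul_comm] at this
    exact this
  rw [h]
  exact zpow_mem (Subgroup.subset_closure (by simp)) k

theorem Bmat_mul_intCast_mem_Gx {R : Type*} [CommRing R] (x : R) (k : ℤ) :
    Bmat (x * k) ∈ Gx x := by
  have h : Bmat (x * k) = Bmat x ^ k := by
    have := map_zpow (BmatHom R) (Multiplicative.ofAdd x) k
    rw [← ofAdd_zsmul, zsmul_eq_mul, mul_comm] at this
    exact this
  rw [h]
  exact zpow_mem (Subgroup.subset_closure (by simp)) k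

theorem map_Gx {R S : Type*} [CommRing R] [CommRing S] (f : R →+* S) (x : R) :
    (Gx x).map (Matrix.SpecialLinearGroup.map f) = Gx (f x) := by
  have hA : Matrix.SpecialLinearGroup.map f (Amat x) = Amat (f x) := by
    ext i j
    fin_cases i <;> fin_cases j <;> simp [coe_Amat]
  have hB : Matrix.SpecialLinearGroup.map f (Bmat x) = Bmat (f x) := by
    ext i j
    fin_cases i <;> fin_cases j <;> simp [coe_Bmat]
  rw [Gx, MonoidHom.map_closure, Set.image_pair, hA, hB, Gx]

/-- Factorization of a matrix whose upper left entry `1 + a²x` has inverse `v`. -/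
theorem eq_Bmat_mul_Amat_mul_Bmat_mul_Amat {R : Type*} [CommRing R] (g : SL2 R) {a x y z v : R}
    (h00 : g 0 0 = 1 + a ^ 2 * x) (h01 : g 0 1 = a * y) (h10 : g 1 0 = a * z)
    (hv : (1 + a ^ 2 * x) * v = 1) :
    g = Bmat (a * ((z - 1) * v)) * Amat (a * x) * Bmat (a * 1) * Amat (a * ((y - x) * v)) := by
  have hdet := Matrix.SpecialLinearGroup.det_coe g
  rw [Matrix.det_fin_two, h00, h01, h10] at hdet
  ext i j
  fin_cases i <;> fin_cases j <;>
    simp only [coe_Amat, coe_Bmat, Matrix.SpecialLinearGroup.coe_mul, Fin.zero_eta, Fin.mk_one,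
      Matrix.mul_apply, Fin.sum_univ_two, Matrix.of_apply, Matrix.cons_val', Matrix.cons_val_zero,
      Matrix.cons_val_one, Matrix.cons_val_fin_one, h00, h01, h10]
  · ring
  · linear_combination (-a * (y - x)) * hv
  · linear_combination (-a * (z - 1)) * hv
  · linear_combination v * hdet - (g 1 1 - (a * ((z - 1) * v) * (a * x
      + (1 + a ^ 2 * x) * (a * ((y - x) * v))) + 1 + a ^ 2 * ((y - x) * v))) * hv
      - v * (a ^ 2 * y * (z - 1) + a ^ 2 * (y - x) * z
        + a ^ 2 * (y - x) * (z - 1) * ((1 + a ^ 2 * x) * v - 1)) * hv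

/-- In an arithmetic progression with coprime data, some term is prime to a given `n`. -/
theorem exists_isCoprime_add_mul {p d : ℤ} (h : IsCoprime p d) {n : ℕ} (hn : n ≠ 0) :
    ∃ k : ℤ, IsCoprime (p + d * k) n := by
  refine ⟨∏ q ∈ n.primeFactors with ¬ ((q : ℕ) : ℤ) ∣ p, (q : ℤ), ?_⟩
  rw [Int.isCoprime_iff_gcd_eq_one]
  by_contra hne
  obtain ⟨q, hq, hqdvd⟩ := Nat.exists_prime_and_dvd hne
  have hq' : Prime (q : ℤ) := Nat.prime_iff_prime_int.mp hq
  have h1 : (q : ℤ) ∣ p + d * ∏ q ∈ n.primeFactors with ¬ ((q : ℕ) : ℤ) ∣ p, (q : ℤ) :=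
    (Int.natCast_dvd_natCast.mpr hqdvd).trans (Int.gcd_dvd_left ..)
  have h2 : q ∣ n :=
    Int.natCast_dvd_natCast.mp ((Int.natCast_dvd_natCast.mpr hqdvd).trans (Int.gcd_dvd_right ..))
  by_cases hp : (q : ℤ) ∣ p
  · rcases hq'.dvd_or_dvd ((dvd_add_right hp).mp h1) with hd | hd
    · exact hq'.not_isUnit (h.isUnit_of_dvd' hp hd)
    · obtain ⟨r, hr, hqr⟩ := (hq'.dvd_finsetProd_iff _).mp hd
      simp only [Finset.mem_filter, Nat.mem_primeFactors] at hr
      rw [(Nat.prime_dvd_prime_iff_eq hq hr.1.1).mp (Int.natCast_dvd_natCast.mp hqr)] at hp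
      exact hr.2 hp
  · refine hp ((dvd_add_left (Dvd.dvd.mul_left (Finset.dvd_prod_of_mem _ ?_) d)).mp h1)
    simp [hq, h2, hn, hp]

theorem dvd_sub_of_mem_PCSZ {n : ℕ} {g : SL2 ℤ} (hg : g ∈ PCSZ n) (i j : Fin 2) :
    (n : ℤ) ∣ g i j - (1 : Matrix (Fin 2) (Fin 2) ℤ) i j := by
  have h := congrArg (fun m : SL2 (ZMod n) => m i j) (MonoidHom.mem_ker.mp hg)
  rw [← ZMod.intCast_eq_intCast_iff_dvd_sub]
  fin_cases i <;> fin_cases j <;> simpa using h.symm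

theorem map_mem_Gx_of_mem_PCSZ_sq {a n : ℕ} (hn : n ≠ 0) {g : SL2 ℤ} (hg : g ∈ PCSZ (a ^ 2)) :
    Matrix.SpecialLinearGroup.map (Int.castRingHom (ZMod n)) g ∈ Gx (a : ZMod n) := by
  obtain ⟨x, hx⟩ := dvd_sub_of_mem_PCSZ hg 0 0
  obtain ⟨y, hy⟩ := dvd_sub_of_mem_PCSZ hg 0 1
  obtain ⟨z, hz⟩ := dvd_sub_of_mem_PCSZ hg 1 0
  simp only [Matrix.one_apply_eq, ne_eq, zero_ne_one, one_ne_zero, not_false_eq_true,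
    Matrix.one_apply_ne, sub_zero, Nat.cast_pow] at hx hy hz
  have hdet := Matrix.SpecialLinearGroup.det_coe g
  rw [Matrix.det_fin_two] at hdet
  have hcop : IsCoprime (g 0 0) (a * g 1 0) := by
    refine IsCoprime.mul_right ⟨1, -(a * x), ?_⟩ ⟨g 1 1, -g 0 1, ?_⟩
    · linear_combination hx
    · linear_combination hdet
  obtain ⟨k, hk⟩ := exists_isCoprime_add_mul hcop hn
  have hk00 : g 0 0 + a * g 1 0 * k = 1 + a ^ 2 * (x + a * z * k) := by
    linear_combination hx + a * k * hz
  rw [hk00] at hk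
  obtain ⟨v, w, hvw⟩ := hk
  have hv : (1 + (a : ZMod n) ^ 2 * ((x + a * z * k : ℤ) : ZMod n)) * v = 1 := by
    have := congrArg (Int.cast : ℤ → ZMod n) hvw
    push_cast at this ⊢
    rw [ZMod.natCast_self] at this
    linear_combination this
  set φ := Matrix.SpecialLinearGroup.map (n := Fin 2) (Int.castRingHom (ZMod n))
  have hA : φ (Amat (a * k)) ∈ Gx (a : ZMod n) := by
    have := Subgroup.mem_map_of_mem φ (Amat_mul_intCast_mem_Gx (a : ℤ) k)
    rw [map_Gx] at this
    simpa using this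
  rw [← Subgroup.mul_mem_cancel_left _ hA, ← map_mul]
  have hcoe (i j : Fin 2) :
      φ (Amat (a * k) * g) i j = (((Amat (a * k) * g : SL2 ℤ) i j : ℤ) : ZMod n) :=
    rfl
  rw [eq_Bmat_mul_Amat_mul_Bmat_mul_Amat (φ (Amat (a * k) * g)) (a := (a : ZMod n))
    (x := ((x + a * z * k : ℤ) : ZMod n)) (y := ((a * y + k * g 1 1 : ℤ) : ZMod n))
    (z := ((a * z : ℤ) : ZMod n)) (v := v) ?_ ?_ ?_ hv]
  · refine mul_mem (mul_mem (mul_mem ?_ ?_) ?_) ?_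
    · exact_mod_cast Bmat_mul_intCast_mem_Gx (a : ZMod n) ((a * z - 1) * v)
    · exact Amat_mul_intCast_mem_Gx (a : ZMod n) _
    · exact_mod_cast Bmat_mul_intCast_mem_Gx (a : ZMod n) 1
    · exact_mod_cast Amat_mul_intCast_mem_Gx (a : ZMod n)
        ((a * y + k * g 1 1 - (x + a * z * k)) * v)
  · have h : (Amat (a * k) * g : SL2 ℤ) 0 0 = 1 + a ^ 2 * (x + a * z * k) := by
      simp [coe_Amat, Matrix.mul_apply, Fin.sum_univ_two]
      linear_combination hk00
    rw [hcoe, h]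
    push_cast
    ring
  · have h : (Amat (a * k) * g : SL2 ℤ) 0 1 = a * (a * y + k * g 1 1) := by
      simp [coe_Amat, Matrix.mul_apply, Fin.sum_univ_two]
      linear_combination hy
    rw [hcoe, h]
    push_cast
    ring
  · have h : (Amat (a * k) * g : SL2 ℤ) 1 0 = a * (a * z) := by
      simp [coe_Amat, Matrix.mul_apply, Fin.sum_univ_two]
      linear_combination hz
    rw [hcoe, h]
    push_cast
    ring

theorem mulSubgroup_eq_sup {G : Type*} [Group G] (H N : Subgroup G) [N.Normal] :
    mulSubgroup H N = H ⊔ N :=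
  Subgroup.copy_eq ..

/-- For `a ≥ 1`, the intersection over all positive integers `n` of the subgroups
`G(a)·Γ(n)` of `SL(2,ℤ)` equals `G(a)·Γ(a²)`. -/
theorem stmt_18 (a : ℕ) (ha : 1 ≤ a) :
    (⨅ n ∈ {n : ℕ | 0 < n}, mulSubgroup (Gx ((a : ℤ))) (PCSZ n)) =
      mulSubgroup (Gx ((a : ℤ))) (PCSZ (a ^ 2)) := by
  refine le_antisymm (iInf₂_le (a ^ 2) (pow_pos ha 2)) (le_iInf₂ fun n hn => ?_)
  rw [mulSubgroup_eq_sup, mulSubgroup_eq_sup]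
  refine sup_le le_sup_left fun g hg => ?_
  rw [← Subgroup.comap_map_eq, Subgroup.mem_comap, map_Gx]
  simpa using map_mem_Gx_of_mem_PCSZ_sq (Nat.pos_iff_ne_zero.mp hn) hg
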